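/- As the real variable x tends to infinity, 2x·sin(π/(2x))·(cos(δ₀(x)/2) − cos(δ_B(x)/2)) − π⁷/(32x⁶) = O(1/x⁸); that is, the perimeter of the polygon D_x exceeds the perimeter of the polygon B_x by π⁷/(32x⁶) + O(1/x⁸). -/

import Mathlib

open Real Filter Asymptotics

/-- `δ₀(x) = arctan(tan(2π/x)·tan(π/x)) − arcsin(sin(2π/x)·sin(π/x) / √(4·sin(π/x)² + cos(4π/x)))`. -/
noncomputable def δ₀ (x : ℝ) : ℝ :=
  Real.arctan (Real.tan (2 * π / x) * Real.tan (π / x)) -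
    Real.arcsin (Real.sin (2 * π / x) * Real.sin (π / x) /
      Real.sqrt (4 * Real.sin (π / x) ^ 2 + Real.cos (4 * π / x)))

/-- `δ_B(x) = π/x − arcsin((1/2)·sin(2π/x))`. -/
noncomputable def δB (x : ℝ) : ℝ :=
  π / x - Real.arcsin ((1 / 2) * Real.sin (2 * π / x))

open scoped Topology

theorem Asymptotics.isBigO_pow_pow_nhds_zero {m n : ℕ} (h : m ≤ n) :
    (fun y : ℝ => y ^ n) =O[𝓝 0] fun y => y ^ m := by
  rcases h.eq_or_lt with rfl | h
  · exact isBigO_refl _ _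
  · exact (isLittleO_pow_pow h).isBigO

theorem AnalyticAt.isBigO_sub_sub_deriv_mul {f : ℝ → ℝ} (hf : AnalyticAt ℝ f 0) :
    (fun y => f y - f 0 - deriv f 0 * y) =O[𝓝 0] fun y => y ^ 2 := by
  have h := hf.hasFPowerSeriesAt.isBigO_sub_partialSum_pow 2
  refine (h.congr_left fun y => ?_).trans (isBigO_of_le _ fun y => le_of_eq (by simp))
  simp [FormalMultilinearSeries.partialSum, Finset.sum_range_succ]
  ring

theorem Function.Even.isBigO_sub_of_analyticAt {f : ℝ → ℝ} (he : Function.Even f)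
    (hf : AnalyticAt ℝ f 0) : (fun y => f y - f 0) =O[𝓝 0] fun y => y ^ 2 := by
  have hd : deriv f 0 = 0 := by
    have h := deriv_comp_neg f 0
    rw [show (fun x => f (-x)) = f from funext he, neg_zero] at h
    linarith
  simpa [hd] using hf.isBigO_sub_sub_deriv_mul

theorem Real.sin_sub_self_isBigO : (fun y => sin y - y) =O[𝓝 0] fun y => y ^ 3 := by
  refine IsBigO.of_bound 1 ?_
  filter_upwards [Metric.ball_mem_nhds (0 : ℝ) one_pos] with y hy
  have hy1 : |y| ≤ 1 := by simpa using (mem_ball_zero_iff.1 hy).le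
  have h := Real.sin_bound hy1
  have h3 : |y| ^ 5 ≤ |y| ^ 3 := pow_le_pow_of_le_one (abs_nonneg y) hy1 (by norm_num)
  have h4 : |sin y - y| ≤ |sin y - (y - y ^ 3 / 6)| + |y| ^ 3 / 6 := by
    have h5 := abs_sub (sin y - (y - y ^ 3 / 6)) (y ^ 3 / 6)
    rwa [abs_div (y ^ 3), abs_pow, abs_of_pos (by norm_num : (0 : ℝ) < 6),
      show sin y - (y - y ^ 3 / 6) - y ^ 3 / 6 = sin y - y by ring] at h5
  rw [norm_eq_abs, norm_eq_abs, abs_pow]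
  have := pow_nonneg (abs_nonneg y) 3
  linarith

theorem Real.one_sub_cos_sub_isBigO :
    (fun y => 1 - cos y - y ^ 2 / 2) =O[𝓝 0] fun y => y ^ 4 := by
  refine IsBigO.of_bound 1 ?_
  filter_upwards [Metric.ball_mem_nhds (0 : ℝ) one_pos] with y hy
  have hy1 : |y| ≤ 1 := by simpa using (mem_ball_zero_iff.1 hy).le
  have h := Real.cos_bound hy1
  rw [norm_eq_abs, norm_eq_abs, abs_pow, show 1 - cos y - y ^ 2 / 2 = -(cos y - (1 - y ^ 2 / 2)) by
    ring, abs_neg]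
  have := pow_nonneg (abs_nonneg y) 4
  linarith

theorem Real.one_sub_cos_isBigO {α : Type*} {l : Filter α} (f : α → ℝ) :
    (fun y => 1 - cos (f y)) =O[l] fun y => f y ^ 2 := by
  refine isBigO_of_le _ fun y => ?_
  rw [norm_eq_abs, norm_eq_abs, abs_of_nonneg (by linarith [cos_le_one (f y)]),
    abs_of_nonneg (sq_nonneg _)]
  nlinarith [one_sub_sq_div_two_le_cos (x := f y), sq_nonneg (f y)]

theorem Real.arctan_sub_self_isBigO : (fun y => arctan y - y) =O[𝓝 0] fun y => y ^ 2 := by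
  have h : AnalyticAt ℝ arctan 0 := (contDiff_arctan (n := ⊤)).contDiffAt.analyticAt
  simpa using h.isBigO_sub_sub_deriv_mul

theorem Real.arcsin_sub_self_isBigO : (fun y => arcsin y - y) =O[𝓝 0] fun y => y ^ 2 := by
  have h : AnalyticAt ℝ arcsin 0 :=
    (contDiffAt_arcsin (n := ⊤) (by norm_num) (by norm_num)).analyticAt
  simpa using h.isBigO_sub_sub_deriv_mul

theorem arctan_sub_arcsin_isBigO :
    (fun u : ℝ => arctan (tan (2 * u) * tan u) -
      arcsin (sin (2 * u) * sin u / √(4 * sin u ^ 2 + cos (4 * u)))) =O[𝓝 0] fun u => u ^ 4 := by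
  set g : ℝ → ℝ := fun u => 1 / cos (2 * u) with hg
  set k : ℝ → ℝ := fun u => cos u / √(4 * sin u ^ 2 + cos (4 * u)) with hk
  have hga : AnalyticAt ℝ g 0 := by
    refine (ContDiffAt.div (n := ⊤) (by fun_prop) (by fun_prop) (by simp)).analyticAt
  have hka : AnalyticAt ℝ k 0 := by
    refine (ContDiffAt.div (n := ⊤) (by fun_prop)
      (ContDiffAt.sqrt (by fun_prop) (by simp)) (by simp)).analyticAt
  have hge : (fun u => g u - 1) =O[𝓝 0] fun u : ℝ => u ^ 2 := by
    simpa [hg] using Function.Even.isBigO_sub_of_analyticAt (f := g) (fun u => by simp [hg]) hga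
  have hke : (fun u => k u - 1) =O[𝓝 0] fun u : ℝ => u ^ 2 := by
    simpa [hk] using Function.Even.isBigO_sub_of_analyticAt (f := k) (fun u => by simp [hk]) hka
  have hs : (fun u : ℝ => 2 * sin u ^ 2) =O[𝓝 0] fun u : ℝ => u ^ 2 :=
    (isBigO_of_le _ fun u => by simpa using abs_sin_le_abs).pow 2 |>.const_mul_left 2
  have hp : (fun u : ℝ => tan (2 * u) * tan u) =ᶠ[𝓝 0] fun u => 2 * sin u ^ 2 * g u := by
    have : ∀ᶠ u : ℝ in 𝓝 0, cos u ≠ 0 := continuous_cos.continuousAt.eventually_ne (by simp)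
    filter_upwards [this] with u hu
    rw [tan_eq_sin_div_cos, tan_eq_sin_div_cos, sin_two_mul, hg]
    field_simp
  have hq : (fun u : ℝ => sin (2 * u) * sin u / √(4 * sin u ^ 2 + cos (4 * u))) =
      fun u => 2 * sin u ^ 2 * k u := by
    funext u
    rw [sin_two_mul, hk]
    ring
  have hP : (fun u => 2 * sin u ^ 2 * g u) =O[𝓝 0] fun u : ℝ => u ^ 2 := by
    simpa using hs.mul (hga.continuousAt.tendsto.isBigO_one ℝ)
  have hQ : (fun u => 2 * sin u ^ 2 * k u) =O[𝓝 0] fun u : ℝ => u ^ 2 := by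
    simpa using hs.mul (hka.continuousAt.tendsto.isBigO_one ℝ)
  have h0 : Tendsto (fun u : ℝ => u ^ 2) (𝓝 0) (𝓝 0) := by
    simpa using (continuous_pow (M := ℝ) 2).tendsto 0
  have hA := (arctan_sub_self_isBigO.comp_tendsto (hP.trans_tendsto h0)).trans (hP.pow 2)
  have hB := (arcsin_sub_self_isBigO.comp_tendsto (hQ.trans_tendsto h0)).trans (hQ.pow 2)
  have hC := hs.mul (hge.sub hke)
  simp only [← pow_mul, ← pow_add] at hA hB hC
  refine ((hA.sub hB).add hC).congr' ?_ EventuallyEq.rfl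
  filter_upwards [hp] with u hu
  rw [hu, congrFun hq u]
  simp only [Function.comp]
  ring

theorem self_sub_arcsin_isBigO :
    (fun u : ℝ => u - arcsin (1 / 2 * sin (2 * u)) - u ^ 3 / 2) =O[𝓝 0] fun u => u ^ 5 := by
  set d : ℝ → ℝ := fun u => u - arcsin (1 / 2 * sin (2 * u)) with hd
  have hdc : Continuous d := by fun_prop
  have hd0 : Tendsto d (𝓝 0) (𝓝 0) := by simpa [hd] using hdc.tendsto 0
  have hkey : ∀ u, 2 * sin (d u / 2) * cos (u - d u / 2) = sin u * (1 - cos u) := by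
    intro u
    have h1 : sin (u - d u) = sin u * cos u := by
      rw [show u - d u = arcsin (1 / 2 * sin (2 * u)) by simp [hd], sin_arcsin
        (by linarith [neg_one_le_sin (2 * u)]) (by linarith [sin_le_one (2 * u)]), sin_two_mul]
      ring
    have h2 := sin_sub_sin u (u - d u)
    rw [show (u - (u - d u)) / 2 = d u / 2 by ring,
      show (u + (u - d u)) / 2 = u - d u / 2 by ring] at h2
    rw [← h2, h1]
    ring
  have hsin : (fun u : ℝ => sin u) =O[𝓝 0] fun u => u :=
    isBigO_of_le _ fun u => abs_sin_le_abs
  have hcos := one_sub_cos_isBigO (l := 𝓝 (0 : ℝ)) id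
  simp only [id] at hcos
  have hcc : Tendsto (fun u => cos (u - d u / 2)) (𝓝 0) (𝓝 1) := by
    have : Continuous fun u => cos (u - d u / 2) := by fun_prop
    simpa [hd] using this.tendsto 0
  have hsd : (fun u => 2 * sin (d u / 2)) =O[𝓝 0] fun u : ℝ => u ^ 3 := by
    have h1 := (hsin.mul hcos).mul ((hcc.inv₀ one_ne_zero).isBigO_one ℝ)
    refine h1.congr' ?_ (Eventually.of_forall fun u => by ring)
    filter_upwards [hcc.eventually_ne one_ne_zero] with u hu
    rw [← hkey u, mul_inv_cancel_right₀ hu]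
  have hd3 : d =O[𝓝 0] fun u : ℝ => u ^ 3 := by
    refine IsBigO.trans (IsBigO.of_bound (π / 2) ?_) hsd
    filter_upwards [hd0.eventually (Metric.ball_mem_nhds (0 : ℝ) one_pos)] with u hu
    have hu1 : |d u| < 1 := by simpa using hu
    have h1 : |d u / 2| = |d u| / 2 := by rw [abs_div, abs_two]
    have h2 := mul_abs_le_abs_sin (x := d u / 2) (by rw [h1]; linarith [pi_gt_three])
    rw [h1] at h2
    rw [norm_eq_abs, norm_eq_abs, abs_mul, abs_two]
    calc |d u| = π * (2 / π * (|d u| / 2)) := by field_simp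
      _ ≤ π * |sin (d u / 2)| := by gcongr
      _ = _ := by ring
  have hd1 : d =O[𝓝 0] fun u : ℝ => u := by
    simpa using hd3.trans (isBigO_pow_pow_nhds_zero (m := 1) (by norm_num))
  have h0 : Tendsto (fun u => d u / 2) (𝓝 0) (𝓝 0) := by simpa using hd0.div_const 2
  have hhalf : (fun u => d u / 2) =O[𝓝 0] d := by
    simpa [div_eq_inv_mul] using (isBigO_refl d (𝓝 0)).const_mul_left 2⁻¹
  have e1 : (fun u => 2 * (sin (d u / 2) - d u / 2)) =O[𝓝 0] fun u : ℝ => u ^ 5 := by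
    have h1 := (sin_sub_self_isBigO.comp_tendsto h0).trans ((hhalf.trans hd3).pow 3)
    simp only [← pow_mul] at h1
    exact (h1.trans (isBigO_pow_pow_nhds_zero (by norm_num))).const_mul_left 2
  have e2 : (fun u => 2 * sin (d u / 2) * (1 - cos (u - d u / 2))) =O[𝓝 0] fun u : ℝ => u ^ 5 := by
    have := hsd.mul ((one_sub_cos_isBigO _).trans (((isBigO_refl _ _).sub (hhalf.trans hd1)).pow 2))
    simpa only [← pow_add] using this
  have e3 : (fun u => (sin u - u) * (1 - cos u)) =O[𝓝 0] fun u : ℝ => u ^ 5 := by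
    simpa only [← pow_add] using sin_sub_self_isBigO.mul hcos
  have e4 : (fun u => u * (1 - cos u - u ^ 2 / 2)) =O[𝓝 0] fun u : ℝ => u ^ 5 := by
    simpa only [← pow_succ'] using (isBigO_refl (fun u : ℝ => u) _).mul one_sub_cos_sub_isBigO
  refine (((e2.add e3).add e4).sub e1).congr_left fun u => ?_
  have := hkey u
  linear_combination -this

theorem sin_mul_cos_sub_cos_isBigO {a b : ℝ → ℝ} (ha : a =O[𝓝[≠] 0] fun u => u ^ 4)
    (hb : (fun u => b u - u ^ 3 / 2) =O[𝓝[≠] 0] fun u => u ^ 5) :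
    (fun u : ℝ => sin (u / 2) / (u / 2) * (cos (a u / 2) - cos (b u / 2)) - u ^ 6 / 32)
      =O[𝓝[≠] 0] fun u => u ^ 8 := by
  have hle {m n : ℕ} (h : m ≤ n) : (fun y : ℝ => y ^ n) =O[𝓝[≠] 0] fun y => y ^ m :=
    (isBigO_pow_pow_nhds_zero h).mono nhdsWithin_le_nhds
  have hhalf (f : ℝ → ℝ) : (fun u => f u / 2) =O[𝓝[≠] 0] f := by
    simpa [div_eq_inv_mul] using (isBigO_refl f (𝓝[≠] 0)).const_mul_left 2⁻¹
  have hlim : Tendsto (fun u : ℝ => u ^ 3) (𝓝[≠] 0) (𝓝 0) := by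
    simpa using ((continuous_pow (M := ℝ) 3).tendsto 0).mono_left nhdsWithin_le_nhds
  have hu2 : Tendsto (fun u : ℝ => u / 2) (𝓝[≠] 0) (𝓝 0) := by
    simpa using ((continuous_id.div_const (2 : ℝ)).tendsto 0).mono_left nhdsWithin_le_nhds
  have hb3 : b =O[𝓝[≠] 0] fun u : ℝ => u ^ 3 := by
    have := (hb.trans (hle (by norm_num))).add (hhalf fun u => u ^ 3)
    simpa using this
  have hbh := (hhalf b).trans hb3
  have hca : (fun u => 1 - cos (a u / 2)) =O[𝓝[≠] 0] fun u : ℝ => u ^ 8 := by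
    simpa only [← pow_mul] using (one_sub_cos_isBigO _).trans (((hhalf a).trans ha).pow 2)
  have hcb : (fun u => 1 - cos (b u / 2) - (b u / 2) ^ 2 / 2) =O[𝓝[≠] 0] fun u : ℝ => u ^ 8 := by
    have h := (one_sub_cos_sub_isBigO.comp_tendsto (hbh.trans_tendsto hlim)).trans (hbh.pow 4)
    simp only [← pow_mul] at h
    exact h.trans (hle (by norm_num))
  have hsq : (fun u => (b u - u ^ 3 / 2) * (b u + u ^ 3 / 2)) =O[𝓝[≠] 0] fun u : ℝ => u ^ 8 := by
    simpa only [← pow_add] using hb.mul (hb3.add (hhalf fun u => u ^ 3))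
  have hc : (fun u => cos (a u / 2) - cos (b u / 2) - u ^ 6 / 32)
      =O[𝓝[≠] 0] fun u : ℝ => u ^ 8 := by
    refine ((hcb.sub hca).add (hsq.const_mul_left (1 / 8))).congr_left fun u => ?_
    ring
  have hS1 : (fun u : ℝ => sin (u / 2) / (u / 2) - 1) =O[𝓝[≠] 0] fun u => u ^ 2 := by
    have h := ((sin_sub_self_isBigO.comp_tendsto hu2).trans ((hhalf fun u => u).pow 3)).mul
      (isBigO_refl (fun u : ℝ => (u / 2)⁻¹) _)
    refine (h.congr' ?_ EventuallyEq.rfl).trans (IsBigO.of_bound 2 ?_)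
    · filter_upwards [self_mem_nhdsWithin] with u hu
      have : u ≠ 0 := hu
      simp only [Function.comp]
      field_simp
    · filter_upwards [self_mem_nhdsWithin] with u hu
      have : u ≠ 0 := hu
      rw [show u ^ 3 * (u / 2)⁻¹ = 2 * u ^ 2 by field_simp, norm_mul, norm_two]
  have hS : (fun u : ℝ => sin (u / 2) / (u / 2)) =O[𝓝[≠] 0] fun _ => (1 : ℝ) := by
    have h := (hS1.trans (hle (m := 0) (by norm_num))).add
      (isBigO_refl (fun u : ℝ => u ^ 0) (𝓝[≠] 0))
    simpa using h
  have h1 := hS.mul hc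
  have h2 := hS1.mul ((isBigO_refl (fun u : ℝ => u ^ 6) (𝓝[≠] 0)).const_mul_left (1 / 32))
  simp only [one_mul, ← pow_add] at h1 h2
  refine (h1.add h2).congr_left fun u => ?_
  ring

theorem perimeter_Dn_exceeds_Bn_isBigO :
    (fun x : ℝ => 2 * x * Real.sin (π / (2 * x)) * (Real.cos (δ₀ x / 2) - Real.cos (δB x / 2))
        - π ^ 7 / (32 * x ^ 6))
      =O[atTop] (fun x : ℝ => 1 / x ^ 8) := by
  have hlim : Tendsto (fun x : ℝ => π / x) atTop (𝓝[≠] 0) := by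
    refine tendsto_nhdsWithin_iff.2 ⟨tendsto_const_nhds.div_atTop tendsto_id, ?_⟩
    filter_upwards [eventually_gt_atTop 0] with x hx
    exact (div_pos pi_pos hx).ne'
  have h := ((sin_mul_cos_sub_cos_isBigO (arctan_sub_arcsin_isBigO.mono nhdsWithin_le_nhds)
    (self_sub_arcsin_isBigO.mono nhdsWithin_le_nhds)).comp_tendsto hlim).const_mul_left π
  refine (h.congr' ?_ EventuallyEq.rfl).trans ?_
  · filter_upwards [eventually_gt_atTop 0] with x hx
    have h2 : 2 * (π / x) = 2 * π / x := by ring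
    have h4 : 4 * (π / x) = 4 * π / x := by ring
    have hh : π / x / 2 = π / (2 * x) := by field_simp
    simp only [Function.comp, δ₀, δB, h2, h4, hh]
    have := pi_ne_zero
    field_simp
  · refine ((isBigO_refl (fun x : ℝ => 1 / x ^ 8) atTop).const_mul_left (π ^ 8)).congr_left
      fun x => ?_
    simp only [Function.comp, div_pow]
    ring
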